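/- arXiv:1007.2224 — 2 statements merged into one kernel-verified Lean document; each statement's English description precedes it below -/
import Mathlib

section
/- For any nonnegative integers r_1, …, r_N with ∑_{j=1}^N j·r_j = N, the probability under the Gibbs measure that the permutation has exactly r_j cycles of length j for every j = 1,…,N equals Y^{−1} ∏_{j=1}^N (r_j!)^{−1} ( (e^{−α_j}/j) ∑_{k∈Λ*} e^{−j ε(k)} )^{r_j}, where Y is the Gibbs normalization. -/
open MeasureTheory Filter Topology ENNReal FourierTransform

noncomputable section
open scoped Classical

/-! ### Permutation combinatorics -/

/-- `r_j(π)`: the number of cycles of length `j` in `π ∈ S_N`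
(fixed points count as cycles of length 1). -/
def cycCount {N : ℕ} (π : Equiv.Perm (Fin N)) (j : ℕ) : ℕ :=
  if j = 1 then N - π.cycleType.sum else Multiset.count j π.cycleType

/-- The cycle weight `exp(-∑_{j≥1} α_j r_j(π))` of a permutation `π ∈ S_N`. -/
def permWeight (α : ℕ → ℝ) {N : ℕ} (π : Equiv.Perm (Fin N)) : ℝ :=
  Real.exp (-∑ j ∈ Finset.Icc 1 N, α j * (cycCount π j : ℝ))

/-! ### The spatial model -/

/-- Euclidean space `ℝ^d`. -/
abbrev Eu (d : ℕ) := EuclideanSpace ℝ (Fin d)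

/-- The lattice point `Lz ∈ ℝ^d`, for `z ∈ ℤ^d`. -/
def latPt (d : ℕ) (L : ℝ) (z : Fin d → ℤ) : Eu d :=
  (WithLp.equiv 2 (Fin d → ℝ)).symm (fun i => L * (z i))

/-- The dual lattice point `z/L ∈ Λ* = L⁻¹ℤ^d`, for `z ∈ ℤ^d`. -/
def dualPt (d : ℕ) (L : ℝ) (z : Fin d → ℤ) : Eu d :=
  (WithLp.equiv 2 (Fin d → ℝ)).symm (fun i => (z i) / L)

/-- The cube `Λ ⊆ ℝ^d` of side `L`. -/
def cube (d : ℕ) (L : ℝ) : Set (Eu d) := {x | ∀ i, x i ∈ Set.Ico (0:ℝ) L}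

/-- The periodization `e^{-ξ_Λ(x)} = ∑_{z∈ℤ^d} e^{-ξ(x-Lz)}` (values in `[0,∞]`),
where `f = e^{-ξ}`. -/
def fper (d : ℕ) (f : Eu d → ℝ) (L : ℝ) (x : Eu d) : ℝ≥0∞ :=
  ∑' z : Fin d → ℤ, ENNReal.ofReal (f (x - latPt d L z))

/-- The (unnormalized) Gibbs weight of a permutation `π ∈ S_N`:
`e^{-∑_j α_j r_j(π)} ∫_{Λ^N} ∏_i e^{-ξ_Λ(x_i - x_{π(i)})} dx`. -/
def gibbsW (d : ℕ) (f : Eu d → ℝ) (α : ℕ → ℝ) (L : ℝ) (N : ℕ)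
    (π : Equiv.Perm (Fin N)) : ℝ≥0∞ :=
  ENNReal.ofReal (permWeight α π) *
    ∫⁻ x in Set.univ.pi (fun _ : Fin N => cube d L), ∏ i, fper d f L (x i - x (π i))

/-- The expectation, under the Gibbs measure on `Λ^N × S_N`, of a function of the
permutation alone. -/
def gibbsE (d : ℕ) (f : Eu d → ℝ) (α : ℕ → ℝ) (L : ℝ) (N : ℕ)
    (g : Equiv.Perm (Fin N) → ℝ) : ℝ :=
  (∑ π : Equiv.Perm (Fin N), (gibbsW d f α L N π).toReal * g π) /
    (∑ π : Equiv.Perm (Fin N), (gibbsW d f α L N π).toReal)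

/-- The critical density `ρ_c = ∑_{j≥1} e^{-α_j} ∫_{ℝ^d} e^{-jε(k)} dk`. -/
def rhoC (d : ℕ) (ε : Eu d → ℝ) (α : ℕ → ℝ) : ℝ :=
  ∑' j : ℕ, Real.exp (-α (j+1)) * ∫ k : Eu d, Real.exp (-(((j:ℝ)+1) * ε k))

theorem summable_norm_prod_pi_and_tsum {𝕜 κ ι : Type*} [RCLike 𝕜] [Fintype ι]
    (f : ι → κ → 𝕜) (hf : ∀ i, Summable fun k => ‖f i k‖) :
    (Summable fun K : ι → κ => ‖∏ i, f i (K i)‖) ∧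
      ∑' K : ι → κ, ∏ i, f i (K i) = ∏ i, ∑' k, f i k := by
  have fin_case : ∀ (n : ℕ) (f : Fin n → κ → 𝕜), (∀ i, Summable fun k => ‖f i k‖) →
      (Summable fun K : Fin n → κ => ‖∏ i, f i (K i)‖) ∧
        ∑' K : Fin n → κ, ∏ i, f i (K i) = ∏ i, ∑' k, f i k := by
    intro n
    induction n with
    | zero =>
      intro f hf
      refine ⟨?_, ?_⟩
      · exact (hasSum_fintype _).summable
      · simp
    | succ n ih =>
      intro f hf
      obtain ⟨h1, h2⟩ := ih (fun a => f a.succ) (fun a => hf a.succ)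
      let E : (κ × (Fin n → κ)) ≃ (Fin (n + 1) → κ) := Fin.consEquiv fun _ => κ
      have hE : ∀ p : κ × (Fin n → κ),
          ∏ b, f b (E p b) = f 0 p.1 * ∏ a : Fin n, f a.succ (p.2 a) := by
        intro p
        rw [Fin.prod_univ_succ]
        rfl
      constructor
      · rw [← E.summable_iff]
        refine ((hf 0).mul_norm h1).congr fun p => ?_
        simp only [Function.comp_apply, hE]
      · rw [← E.tsum_eq, Fin.prod_univ_succ, ← h2]
        simp only [hE]
        rw [tsum_mul_tsum_of_summable_norm (hf 0) h1]
  let e := (Fintype.equivFin ι).symm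
  obtain ⟨h1, h2⟩ := fin_case _ (fun a => f (e a)) (fun a => hf (e a))
  let E : (Fin (Fintype.card ι) → κ) ≃ (ι → κ) := e.arrowCongr (Equiv.refl κ)
  have hE : ∀ K : Fin (Fintype.card ι) → κ, ∏ b, f b (E K b) = ∏ a, f (e a) (K a) := by
    intro K
    rw [← e.prod_comp]
    simp [E]
  constructor
  · rw [← E.summable_iff]
    refine h1.congr fun K => ?_
    simp only [Function.comp_apply, hE]
  · rw [← E.tsum_eq, ← e.prod_comp, ← h2]
    simp only [hE]

namespace Equiv.Perm

variable {N : ℕ} (π : Equiv.Perm (Fin N))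

/-- The length of the cycle of `π` represented by `q`. -/
def orbitLen (q : Quotient (SameCycle.setoid π)) : ℕ :=
  (Finset.univ.filter fun i : Fin N => (⟦i⟧ : Quotient (SameCycle.setoid π)) = q).card

theorem orbitLen_mk_of_ne {i : Fin N} (hi : π i ≠ i) :
    orbitLen π ⟦i⟧ = (π.cycleOf i).support.card := by
  unfold orbitLen
  congr 1
  ext j
  rw [mem_support_cycleOf_iff' hi, Finset.mem_filter, Quotient.eq]
  simp only [Finset.mem_univ, true_and]
  exact ⟨fun h => SameCycle.symm h, fun h => SameCycle.symm h⟩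

theorem orbitLen_mk_of_eq {i : Fin N} (hi : π i = i) : orbitLen π ⟦i⟧ = 1 := by
  unfold orbitLen
  rw [Finset.card_eq_one]
  refine ⟨i, ?_⟩
  ext j
  simp only [Finset.mem_filter, Finset.mem_univ, true_and, Finset.mem_singleton]
  refine ⟨fun h => ?_, fun h => by rw [h]⟩
  have h' : SameCycle π i j := SameCycle.symm (Quotient.eq.1 h)
  exact (h'.eq_of_left hi).symm

theorem orbitLen_mk_eq_one_iff {i : Fin N} : orbitLen π ⟦i⟧ = 1 ↔ π i = i := by
  refine ⟨fun h => ?_, orbitLen_mk_of_eq π⟩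
  by_contra hi
  rw [orbitLen_mk_of_ne π hi] at h
  exact card_support_ne_one _ h

theorem card_orbitLen_eq {j : ℕ} (hj : 1 ≤ j) :
    (Finset.univ.filter fun q : Quotient (SameCycle.setoid π) => orbitLen π q = j).card
      = cycCount π j := by
  unfold cycCount
  split_ifs with h1
  · subst h1
    have h2 : N - π.cycleType.sum = (Finset.univ.filter fun i => π i = i).card := by
      rw [sum_cycleType]
      have := Finset.card_compl π.support
      rw [Fintype.card_fin] at this
      rw [← this]
      congr 1
      ext i
      simp
    rw [h2]
    symm
    refine Finset.card_bij (fun i _ => ⟦i⟧) ?_ ?_ ?_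
    · intro i hi
      simpa [orbitLen_mk_eq_one_iff] using hi
    · intro i hi i' _ h
      have hi : π i = i := by simpa using hi
      have h' : SameCycle π i i' := Quotient.eq.1 h
      exact h'.eq_of_left hi
    · intro q hq
      induction q using Quotient.inductionOn with
      | h i => exact ⟨i, by simpa [orbitLen_mk_eq_one_iff] using hq, rfl⟩
  · rw [cycleType_def, Multiset.count_map]
    let φ : Quotient (SameCycle.setoid π) → Equiv.Perm (Fin N) :=
      Quotient.lift (fun i => π.cycleOf i) (fun a b h => SameCycle.cycleOf_eq h)
    have hne : ∀ i, orbitLen π ⟦i⟧ = j → π i ≠ i := by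
      intro i hi h
      rw [orbitLen_mk_of_eq π h] at hi
      exact h1 hi.symm
    have key : (Finset.univ.filter fun q => orbitLen π q = j).card
        = (π.cycleFactorsFinset.filter fun c => j = c.support.card).card := by
      refine Finset.card_bij (fun q _ => φ q) ?_ ?_ ?_
      · intro q hq
        induction q using Quotient.inductionOn with
        | h i =>
          have hq : orbitLen π ⟦i⟧ = j := by simpa using hq
          have hi := hne i hq
          rw [Finset.mem_filter]
          refine ⟨cycleOf_mem_cycleFactorsFinset_iff.2 (mem_support.2 hi), ?_⟩
          rw [← hq, orbitLen_mk_of_ne π hi]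
          rfl
      · intro q hq q' hq' h
        induction q using Quotient.inductionOn with
        | h i =>
          induction q' using Quotient.inductionOn with
          | h i' =>
            have hq : orbitLen π ⟦i⟧ = j := by simpa using hq
            have hi := hne i hq
            have h : π.cycleOf i = π.cycleOf i' := h
            have hm : i ∈ (π.cycleOf i').support := by
              rw [← h, mem_support_cycleOf_iff' hi]
            exact Quotient.eq.2 (SameCycle.symm (mem_support_cycleOf_iff.1 hm).1)
      · intro c hc
        rw [Finset.mem_filter] at hc
        obtain ⟨hc, hj'⟩ := hc
        have hcyc := (mem_cycleFactorsFinset_iff.1 hc).1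
        obtain ⟨i, hi⟩ := hcyc.nonempty_support
        have hci := cycle_is_cycleOf hi hc
        have hii : π i ≠ i := mem_support.1 (mem_cycleFactorsFinset_support_le hc hi)
        refine ⟨⟦i⟧, ?_, hci.symm⟩
        simp only [Finset.mem_filter, Finset.mem_univ, true_and]
        rw [orbitLen_mk_of_ne π hii, ← hci, hj']
    rw [key]
    rfl

theorem orbitLen_mem_Icc (q : Quotient (SameCycle.setoid π)) :
    orbitLen π q ∈ Finset.Icc 1 N := by
  induction q using Quotient.inductionOn with
  | h i =>
    rw [Finset.mem_Icc]
    constructor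
    · exact Finset.card_pos.2 ⟨i, by simp⟩
    · exact (Finset.card_le_univ _).trans (by simp)

/-- Functions constant along the cycles of `π` are functions on the set of cycles. -/
def invariantEquiv (κ : Type*) :
    {K : Fin N → κ // ∀ i, K (π i) = K i} ≃ (Quotient (SameCycle.setoid π) → κ) where
  toFun K := Quotient.lift K.1 (by
    rintro a _ ⟨n, rfl⟩
    have h : ∀ (m : ℕ) (b : Fin N), K.1 ((π ^ m) b) = K.1 b := by
      intro m
      induction m with
      | zero => simp
      | succ m ih => intro b; rw [pow_succ', mul_apply, K.2, ih]
    cases n with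
    | ofNat m => exact (h m a).symm
    | negSucc m =>
      have := h (m + 1) ((π ^ (Int.negSucc m)) a)
      rw [← this, zpow_negSucc, ← mul_apply, mul_inv_cancel, one_apply])
  invFun κ := ⟨fun i => κ ⟦i⟧, fun i => by
    exact congrArg κ (Quotient.sound (sameCycle_apply_left.2 (SameCycle.refl π i)))⟩
  left_inv K := rfl
  right_inv κ := by
    funext q
    induction q using Quotient.inductionOn with
    | h i => rfl

theorem tsum_invariant_prod {κ : Type*} (a : κ → ℝ) (ha0 : ∀ k, 0 ≤ a k) (ha : Summable a)
    (ha1 : ∀ k, a k ≤ 1) :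
    ∑' K : Fin N → κ, (if ∀ i, K (π i) = K i then ∏ i, a (K i) else 0)
      = ∏ j ∈ Finset.Icc 1 N, (∑' k, a k ^ j) ^ cycCount π j := by
  have h1 : ∑' K : Fin N → κ, (if ∀ i, K (π i) = K i then ∏ i, a (K i) else 0)
      = ∑' K : {K : Fin N → κ // ∀ i, K (π i) = K i}, ∏ i, a (K.1 i) := by
    rw [← tsum_subtype_eq_of_support_subset (s := {K : Fin N → κ | ∀ i, K (π i) = K i})]
    · exact tsum_congr fun K => if_pos K.2
    · intro K hK
      by_contra h
      exact hK (if_neg h)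
  have h2 : ∀ K : Quotient (SameCycle.setoid π) → κ,
      ∏ i, a (((invariantEquiv π κ).symm K).1 i) = ∏ q, a (K q) ^ orbitLen π q := by
    intro K
    rw [← Finset.prod_fiberwise Finset.univ
      (fun i => (⟦i⟧ : Quotient (SameCycle.setoid π)))]
    refine Finset.prod_congr rfl fun q _ => ?_
    rw [orbitLen, ← Finset.prod_const]
    refine Finset.prod_congr rfl fun i hi => ?_
    rw [← (Finset.mem_filter.1 hi).2]
    rfl
  rw [h1, ← (invariantEquiv π κ).symm.tsum_eq]
  simp only [h2]
  rw [(summable_norm_prod_pi_and_tsum (fun q k => a k ^ orbitLen π q) ?_).2,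
    ← Finset.prod_fiberwise_of_maps_to (fun q _ => orbitLen_mem_Icc π q)]
  · refine Finset.prod_congr rfl fun j hj => ?_
    rw [← card_orbitLen_eq π (Finset.mem_Icc.1 hj).1, ← Finset.prod_const]
    refine Finset.prod_congr rfl fun q hq => ?_
    rw [(Finset.mem_filter.1 hq).2]
  · intro q
    refine Summable.of_nonneg_of_le (fun k => norm_nonneg _) (fun k => ?_) ha
    rw [Real.norm_of_nonneg (pow_nonneg (ha0 k) _)]
    exact pow_le_of_le_one (ha0 k) (ha1 k)
      (Nat.one_le_iff_ne_zero.1 (Finset.mem_Icc.1 (orbitLen_mem_Icc π q)).1)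

theorem cycCount_eq_iff {r : ℕ → ℕ} (hr : ∑ j ∈ Finset.Icc 1 N, j * r j = N) :
    (∀ j ∈ Finset.Icc 1 N, cycCount π j = r j) ↔
      π.cycleType = ∑ j ∈ Finset.Icc 2 N, Multiset.replicate (r j) j := by
  have hcount : ∀ j, Multiset.count j (∑ j ∈ Finset.Icc 2 N, Multiset.replicate (r j) j)
      = if j ∈ Finset.Icc 2 N then r j else 0 := by
    intro j
    rw [Multiset.count_sum']
    simp [Multiset.count_replicate]
  have hsum : (∑ j ∈ Finset.Icc 2 N, Multiset.replicate (r j) j).sum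
      = ∑ j ∈ Finset.Icc 2 N, j * r j := by
    rw [Multiset.sum_sum]
    simp [mul_comm]
  constructor
  · intro h
    ext j
    rw [hcount]
    split_ifs with hj
    · rw [Finset.mem_Icc] at hj
      rw [← h j (Finset.mem_Icc.2 ⟨by omega, hj.2⟩), cycCount, if_neg (by omega)]
    · rw [Multiset.count_eq_zero]
      intro hm
      refine hj (Finset.mem_Icc.2 ⟨two_le_of_mem_cycleType hm, ?_⟩)
      exact (le_card_support_of_mem_cycleType hm).trans
        ((Finset.card_le_univ _).trans (by simp))
  · intro h j hj
    rw [Finset.mem_Icc] at hj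
    unfold cycCount
    rw [h]
    split_ifs with h1
    · subst h1
      rw [hsum]
      rw [← Finset.insert_Icc_succ_left_eq_Icc hj.2,
        Finset.sum_insert (by simp)] at hr
      simp only [one_mul] at hr
      have h3 : Order.succ 1 = 2 := rfl
      rw [h3] at hr
      omega
    · rw [hcount, if_pos (Finset.mem_Icc.2 ⟨by omega, hj.2⟩)]

theorem card_cycCount_eq_mul {r : ℕ → ℕ} (hr : ∑ j ∈ Finset.Icc 1 N, j * r j = N) :
    (Finset.univ.filter fun π : Equiv.Perm (Fin N) =>
        ∀ j ∈ Finset.Icc 1 N, cycCount π j = r j).card *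
      ∏ j ∈ Finset.Icc 1 N, ((r j).factorial * j ^ r j) = N.factorial := by
  set m : Multiset ℕ := ∑ j ∈ Finset.Icc 2 N, Multiset.replicate (r j) j with hm
  have hsum : m.sum = ∑ j ∈ Finset.Icc 2 N, j * r j := by
    rw [hm, Multiset.sum_sum]
    simp [mul_comm]
  have hprod : m.prod = ∏ j ∈ Finset.Icc 2 N, j ^ r j := by
    rw [hm, Multiset.prod_sum]
    simp
  have hcount : ∀ j, Multiset.count j m = if j ∈ Finset.Icc 2 N then r j else 0 := by
    intro j
    rw [hm, Multiset.count_sum']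
    simp [Multiset.count_replicate]
  have hfac : ∏ n ∈ m.toFinset, (m.count n).factorial = ∏ j ∈ Finset.Icc 2 N, (r j).factorial := by
    have hc : ∏ j ∈ Finset.Icc 2 N, (r j).factorial
        = ∏ j ∈ Finset.Icc 2 N, (m.count j).factorial :=
      Finset.prod_congr rfl fun j hj => by rw [hcount, if_pos hj]
    rw [hc]
    refine Finset.prod_subset ?_ ?_
    · intro j hj
      have : Multiset.count j m ≠ 0 := Multiset.count_ne_zero.2 (Multiset.mem_toFinset.1 hj)
      rw [hcount] at this
      by_contra h
      exact this (if_neg h)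
    · intro j _ hj
      rw [Multiset.count_eq_zero.2 (fun h => hj (Multiset.mem_toFinset.2 h)), Nat.factorial_zero]
  have hmain := card_of_cycleType_mul_eq (α := Fin N) m
  have h2 : ∀ a ∈ m, 2 ≤ a := by
    intro a ha
    have : Multiset.count a m ≠ 0 := Multiset.count_ne_zero.2 ha
    rw [hcount] at this
    by_contra h
    exact this (if_neg (by rw [Finset.mem_Icc]; omega))
  have hset : (Finset.univ.filter fun π : Equiv.Perm (Fin N) =>
        ∀ j ∈ Finset.Icc 1 N, cycCount π j = r j)
      = Finset.univ.filter fun π : Equiv.Perm (Fin N) => π.cycleType = m := by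
    ext π
    simp only [Finset.mem_filter, Finset.mem_univ, true_and, cycCount_eq_iff π hr, hm]
  rw [hset]
  rw [Fintype.card_fin] at hmain
  rcases Nat.eq_zero_or_pos N with h0 | hN
  · subst h0
    simpa [hm] using hmain
  rw [← Finset.insert_Icc_succ_left_eq_Icc hN, Finset.sum_insert (by simp)] at hr
  have h3 : Order.succ 1 = 2 := rfl
  rw [h3, one_mul, ← hsum] at hr
  rw [if_pos ⟨by omega, h2⟩, hfac, hprod] at hmain
  rw [← Finset.insert_Icc_succ_left_eq_Icc hN, Finset.prod_insert (by simp), h3,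
    Finset.prod_mul_distrib, one_pow, mul_one, ← hmain,
    show N - m.sum = r 1 by omega]
  ring_nf

end Equiv.Perm

/-! ### Plane waves on the cube -/

/-- The plane wave `x ↦ e^{2πi k·x/L}`. -/
def wave {d : ℕ} (L : ℝ) (k : Fin d → ℤ) (x : Eu d) : ℂ :=
  Complex.exp (∑ i, 2 * Real.pi * Complex.I * k i * x i / L)

section Wave

variable {d : ℕ} {L : ℝ}

theorem wave_add (k : Fin d → ℤ) (x y : Eu d) :
    wave L k (x + y) = wave L k x * wave L k y := by
  simp only [wave, ← Complex.exp_add, ← Finset.sum_add_distrib]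
  congr 1
  refine Finset.sum_congr rfl fun i _ => ?_
  push_cast [PiLp.add_apply]
  ring

theorem wave_index_add (k l : Fin d → ℤ) (x : Eu d) :
    wave L (k + l) x = wave L k x * wave L l x := by
  simp only [wave, ← Complex.exp_add, ← Finset.sum_add_distrib]
  congr 1
  refine Finset.sum_congr rfl fun i _ => ?_
  push_cast [Pi.add_apply]
  ring

@[simp] theorem wave_zero_index (x : Eu d) : wave L (0 : Fin d → ℤ) x = 1 := by
  simp [wave]

@[simp] theorem wave_zero_arg (k : Fin d → ℤ) : wave L k 0 = 1 := by
  simp [wave]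

theorem wave_neg (k : Fin d → ℤ) (x : Eu d) : wave L k (-x) = wave L (-k) x := by
  simp [wave]

theorem wave_neg_mul_self (k : Fin d → ℤ) (x : Eu d) : wave L (-k) x * wave L k x = 1 := by
  rw [← wave_index_add]
  simp

@[simp] theorem norm_wave (k : Fin d → ℤ) (x : Eu d) : ‖wave L k x‖ = 1 := by
  have h : (∑ i, 2 * Real.pi * Complex.I * k i * x i / L : ℂ)
      = ((∑ i, 2 * Real.pi * k i * x i / L : ℝ) : ℂ) * Complex.I := by
    push_cast
    rw [Finset.sum_mul]
    refine Finset.sum_congr rfl fun i _ => ?_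
    ring
  rw [wave, h, Complex.norm_exp_ofReal_mul_I]

@[fun_prop] theorem continuous_wave (k : Fin d → ℤ) : Continuous (wave (d := d) L k) := by
  unfold wave
  fun_prop

theorem wave_latPt (hL : 0 < L) (k z : Fin d → ℤ) : wave L k (latPt d L z) = 1 := by
  have h : (∑ i, 2 * Real.pi * Complex.I * k i * (latPt d L z) i / L : ℂ)
      = ((∑ i, k i * z i : ℤ) : ℂ) * (2 * Real.pi * Complex.I) := by
    push_cast
    rw [Finset.sum_mul]
    refine Finset.sum_congr rfl fun i _ => ?_
    have : (L : ℂ) ≠ 0 := by exact_mod_cast hL.ne'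
    simp only [latPt, WithLp.equiv_symm_apply, Complex.ofReal_mul, Complex.ofReal_intCast]
    field_simp
  rw [wave, h, Complex.exp_int_mul_two_pi_mul_I]

/-- The closed cube of side `L`. -/
def closedCube (d : ℕ) (L : ℝ) : Set (Eu d) := {x | ∀ i, x i ∈ Set.Icc (0 : ℝ) L}

theorem cube_eq_preimage : cube d L =
    (WithLp.ofLp : Eu d → Fin d → ℝ) ⁻¹' (Set.univ.pi fun _ => Set.Ico (0 : ℝ) L) := by
  ext x
  simp [cube]

theorem closedCube_eq_preimage : closedCube d L =
    (WithLp.ofLp : Eu d → Fin d → ℝ) ⁻¹' (Set.univ.pi fun _ => Set.Icc (0 : ℝ) L) := by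
  ext x
  simp [closedCube, Pi.le_def, forall_and]

theorem measurableSet_cube : MeasurableSet (cube d L) := by
  rw [cube_eq_preimage]
  exact (PiLp.volume_preserving_ofLp (Fin d)).measurable
    (MeasurableSet.univ_pi fun _ => measurableSet_Ico)

theorem isCompact_closedCube : IsCompact (closedCube d L) := by
  rw [closedCube_eq_preimage]
  exact (PiLp.homeomorph 2 (fun _ : Fin d => ℝ)).isClosedEmbedding.isCompact_preimage
    (isCompact_univ_pi fun _ => isCompact_Icc)

theorem cube_ae_eq_closedCube : cube d L =ᵐ[volume] closedCube d L := by
  rw [cube_eq_preimage, closedCube_eq_preimage, Set.pi_univ_Icc]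
  exact (PiLp.volume_preserving_ofLp (Fin d)).quasiMeasurePreserving.preimage_ae_eq
    Measure.univ_pi_Ico_ae_eq_Icc

theorem volume_cube_ne_top : volume (cube d L) ≠ ⊤ := by
  rw [measure_congr cube_ae_eq_closedCube]
  exact isCompact_closedCube.measure_lt_top.ne

instance : IsFiniteMeasure (volume.restrict (cube d L)) :=
  ⟨by simpa using volume_cube_ne_top.lt_top⟩

theorem integral_cube_wave (hL : 0 < L) (k : Fin d → ℤ) :
    ∫ x in cube d L, wave L k x = if k = 0 then (L : ℂ) ^ d else 0 := by
  have hLc : (L : ℂ) ≠ 0 := by exact_mod_cast hL.ne'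
  have h1 : ∫ x in cube d L, wave L k x
      = ∫ y in Set.univ.pi (fun _ : Fin d => Set.Ico (0 : ℝ) L),
        ∏ i, Complex.exp (2 * Real.pi * Complex.I * k i * y i / L) := by
    rw [cube_eq_preimage, ← (PiLp.volume_preserving_ofLp (Fin d)).setIntegral_preimage_emb
      (MeasurableEquiv.toLp 2 (Fin d → ℝ)).symm.measurableEmbedding]
    refine integral_congr_ae (ae_of_all _ fun x => ?_)
    simp only [wave, Complex.exp_sum]
  have h2 : ∀ m : ℤ, ∫ t in Set.Ico (0 : ℝ) L, Complex.exp (2 * Real.pi * Complex.I * m * t / L)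
      = if m = 0 then (L : ℂ) else 0 := by
    intro m
    rw [integral_Ico_eq_integral_Ioc, ← intervalIntegral.integral_of_le hL.le]
    split_ifs with hm
    · simp [hm]
    · have hm' : (2 * Real.pi * Complex.I * m / L : ℂ) ≠ 0 := by
        have : (m : ℂ) ≠ 0 := by exact_mod_cast hm
        have := Real.pi_ne_zero
        simp [*]
      have h3 := integral_exp_mul_complex (a := 0) (b := L) hm'
      have h4 : (2 * Real.pi * Complex.I * m / L * L : ℂ) = m * (2 * Real.pi * Complex.I) := by
        field_simp
      rw [h4, Complex.exp_int_mul_two_pi_mul_I] at h3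
      simp only [Complex.ofReal_zero, mul_zero, Complex.exp_zero, sub_self, zero_div] at h3
      rw [← h3]
      refine intervalIntegral.integral_congr fun t _ => ?_
      congr 1
      ring
  rw [h1, volume_pi, Measure.restrict_pi_pi,
    integral_fintype_prod_eq_prod
      (f := fun i (t : ℝ) => Complex.exp (2 * Real.pi * Complex.I * k i * t / L))]
  simp only [h2]
  split_ifs with hk
  · simp [hk]
  · obtain ⟨i, hi⟩ := Function.ne_iff.1 hk
    exact Finset.prod_eq_zero (Finset.mem_univ i) (if_neg hi)

end Wave

/-! ### Unfolding along the period lattice -/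

section Unfold

variable {d : ℕ} {L : ℝ}

theorem mem_cube_add_latPt_iff (hL : 0 < L) (x : Eu d) (z : Fin d → ℤ) :
    x + latPt d L z ∈ cube d L ↔ ∀ i, ⌊x i / L⌋ = -z i := by
  simp only [cube, Set.mem_ofPred_eq, PiLp.add_apply, latPt, WithLp.equiv_symm_apply, Set.mem_Ico]
  refine forall_congr' fun i => ?_
  rw [Int.floor_eq_iff, le_div_iff₀ hL, div_lt_iff₀ hL]
  push_cast
  constructor <;> rintro ⟨h1, h2⟩ <;> constructor <;> nlinarith

/-- The translate of the cube by `-Lz`. -/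
def tile (d : ℕ) (L : ℝ) (z : Fin d → ℤ) : Set (Eu d) := (· + latPt d L z) ⁻¹' cube d L

theorem measurableSet_tile (z : Fin d → ℤ) : MeasurableSet (tile d L z) :=
  measurableSet_cube.preimage (measurable_add_const _)

theorem pairwise_disjoint_tile (hL : 0 < L) : Pairwise (Function.onFun Disjoint (tile d L)) := by
  intro z w hzw
  refine Set.disjoint_left.2 fun x hx hx' => hzw ?_
  have h1 := (mem_cube_add_latPt_iff hL x z).1 hx
  have h2 := (mem_cube_add_latPt_iff hL x w).1 hx'
  funext i
  have := h1 i
  have := h2 i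
  omega

theorem iUnion_tile (hL : 0 < L) : ⋃ z, tile d L z = Set.univ := by
  refine Set.eq_univ_of_forall fun x => Set.mem_iUnion.2 ⟨fun i => -⌊x i / L⌋, ?_⟩
  exact (mem_cube_add_latPt_iff hL x _).2 fun i => by simp

theorem hasSum_integral_cube_sub {E : Type*} [NormedAddCommGroup E] [NormedSpace ℝ E]
    (hL : 0 < L) {F : Eu d → E} (hF : Integrable F) :
    HasSum (fun z : Fin d → ℤ => ∫ y in cube d L, F (y - latPt d L z)) (∫ y, F y) := by
  have h := hasSum_integral_iUnion (μ := volume) (f := F) (s := tile d L)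
    (fun z => measurableSet_tile z) (pairwise_disjoint_tile hL) (hF.integrableOn)
  rw [iUnion_tile hL, setIntegral_univ] at h
  convert h using 2 with z
  rw [tile, ← (measurePreserving_add_right volume (latPt d L z)).setIntegral_preimage_emb
    (MeasurableEquiv.addRight (latPt d L z)).measurableEmbedding]
  simp

theorem tsum_lintegral_cube_sub (hL : 0 < L) (F : Eu d → ℝ≥0∞) :
    ∑' z : Fin d → ℤ, ∫⁻ y in cube d L, F (y - latPt d L z) = ∫⁻ y, F y := by
  have h := lintegral_iUnion (μ := volume) (s := tile d L)
    (fun z => measurableSet_tile z) (pairwise_disjoint_tile hL) F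
  rw [iUnion_tile hL, setLIntegral_univ] at h
  rw [h]
  refine tsum_congr fun z => ?_
  rw [tile, ← (measurePreserving_add_right volume (latPt d L z)).setLIntegral_comp_preimage_emb
    (MeasurableEquiv.addRight (latPt d L z)).measurableEmbedding]
  simp

theorem integral_cube_tsum_sub {E : Type*} [NormedAddCommGroup E] [NormedSpace ℝ E]
    [CompleteSpace E] (hL : 0 < L) {F : Eu d → E} (hF : Integrable F) :
    ∫ y in cube d L, ∑' z : Fin d → ℤ, F (y - latPt d L z) = ∫ y, F y := by
  have h := hasSum_integral_of_summable_integral_norm (μ := volume.restrict (cube d L))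
    (F := fun (z : Fin d → ℤ) y => F (y - latPt d L z))
    (fun z => (hF.comp_sub_right _).integrableOn)
    (hasSum_integral_cube_sub hL hF.norm).summable
  exact h.unique (hasSum_integral_cube_sub hL hF)

end Unfold

/-! ### Trigonometric polynomials with nonnegative coefficients -/

section PosTrig

variable {d : ℕ} {L : ℝ}

/-- `u` is a finite combination of plane waves with nonnegative coefficients. -/
def IsPosTrig (L : ℝ) (u : Eu d → ℂ) : Prop :=
  ∃ (ι : Type) (_ : Fintype ι) (c : ι → ℝ) (k : ι → Fin d → ℤ),
    (∀ i, 0 ≤ c i) ∧ ∀ y, u y = ∑ i, (c i : ℂ) * wave L (-k i) y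

theorem IsPosTrig.const_mul_wave {c : ℝ} (hc : 0 ≤ c) (k : Fin d → ℤ) :
    IsPosTrig L fun y => (c : ℂ) * wave L k y :=
  ⟨Unit, inferInstance, fun _ => c, fun _ => -k, fun _ => hc, fun y => by simp⟩

theorem IsPosTrig.add {u v : Eu d → ℂ} (hu : IsPosTrig L u) (hv : IsPosTrig L v) :
    IsPosTrig L fun y => u y + v y := by
  obtain ⟨ι, _, c, k, hc, hu⟩ := hu
  obtain ⟨ι', _, c', k', hc', hv⟩ := hv
  refine ⟨ι ⊕ ι', inferInstance, Sum.elim c c', Sum.elim k k', ?_, fun y => ?_⟩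
  · rintro (i | i)
    · exact hc i
    · exact hc' i
  · simp [hu, hv]

theorem IsPosTrig.mul {u v : Eu d → ℂ} (hu : IsPosTrig L u) (hv : IsPosTrig L v) :
    IsPosTrig L fun y => u y * v y := by
  obtain ⟨ι, _, c, k, hc, hu⟩ := hu
  obtain ⟨ι', _, c', k', hc', hv⟩ := hv
  refine ⟨ι × ι', inferInstance, fun p => c p.1 * c' p.2, fun p => k p.1 + k' p.2,
    fun p => mul_nonneg (hc _) (hc' _), fun y => ?_⟩
  simp only [hu, hv]
  rw [Finset.sum_mul_sum, Fintype.sum_prod_type]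
  refine Finset.sum_congr rfl fun i _ => Finset.sum_congr rfl fun i' _ => ?_
  rw [neg_add, wave_index_add]
  push_cast
  ring

theorem IsPosTrig.one : IsPosTrig L fun _ : Eu d => (1 : ℂ) := by
  simpa using IsPosTrig.const_mul_wave (L := L) zero_le_one (0 : Fin d → ℤ)

theorem IsPosTrig.prod {ι : Type*} (s : Finset ι) {u : ι → Eu d → ℂ}
    (hu : ∀ i, IsPosTrig L (u i)) : IsPosTrig L fun y => ∏ i ∈ s, u i y := by
  induction s using Finset.induction_on with
  | empty => simpa using IsPosTrig.one
  | insert a s ha ih => simpa [Finset.prod_insert ha] using (hu a).mul ih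

theorem IsPosTrig.pow {u : Eu d → ℂ} (hu : IsPosTrig L u) (n : ℕ) :
    IsPosTrig L fun y => u y ^ n := by
  simpa using IsPosTrig.prod (Finset.range n) fun _ => hu

theorem IsPosTrig.exists_finset {u : Eu d → ℂ} (hu : IsPosTrig L u) :
    ∃ (T : Finset (Fin d → ℤ)) (b : (Fin d → ℤ) → ℝ), (∀ k, 0 ≤ b k) ∧ (∀ k ∉ T, b k = 0) ∧
      ∀ y, u y = ∑ k ∈ T, (b k : ℂ) * wave L (-k) y := by
  obtain ⟨ι, _, c, k, hc, hu⟩ := hu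
  refine ⟨Finset.univ.image k, fun l => ∑ i with k i = l, c i,
    fun l => Finset.sum_nonneg fun i _ => hc i, fun l hl => ?_, fun y => ?_⟩
  · refine Finset.sum_eq_zero fun i hi => absurd ?_ hl
    rw [← (Finset.mem_filter.1 hi).2]
    exact Finset.mem_image_of_mem k (Finset.mem_univ i)
  · rw [hu, ← Finset.sum_fiberwise_of_maps_to
      (fun i _ => Finset.mem_image_of_mem k (Finset.mem_univ i))]
    refine Finset.sum_congr rfl fun l _ => ?_
    push_cast
    rw [Finset.sum_mul]
    refine Finset.sum_congr rfl fun i hi => ?_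
    rw [(Finset.mem_filter.1 hi).2]

/-- The center of the cube. -/
def center (d : ℕ) (L : ℝ) : Eu d := WithLp.toLp 2 fun _ => L / 2

/-- A nonnegative trigonometric polynomial with a unique maximum at the origin of the torus. -/
def bump (L : ℝ) (y : Eu d) : ℝ := ∏ i, (1 + Real.cos (2 * Real.pi * y i / L)) / 2

theorem isPosTrig_bump : IsPosTrig L fun y : Eu d => (bump L y : ℂ) := by
  have h : ∀ (i : Fin d) (y : Eu d), (((1 + Real.cos (2 * Real.pi * y i / L)) / 2 : ℝ) : ℂ)
      = (1 / 2 : ℝ) * wave L 0 y + ((1 / 4 : ℝ) * wave L (Pi.single i 1) y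
        + (1 / 4 : ℝ) * wave L (-Pi.single i 1) y) := by
    intro i y
    have h1 : ∀ m : ℤ, wave L (Pi.single i m) y
        = Complex.exp ((m * (2 * Real.pi * y i / L) : ℂ) * Complex.I) := by
      intro m
      rw [wave, Finset.sum_eq_single i]
      · congr 1
        simp only [Pi.single_eq_same]
        ring
      · intro j _ hj
        simp [Pi.single_eq_of_ne hj]
      · simp
    rw [← Pi.single_neg, h1, h1, wave_zero_index]
    push_cast
    rw [Complex.cos]
    simp only [one_mul, neg_mul]
    ring
  simp only [bump, Complex.ofReal_prod]
  refine IsPosTrig.prod _ fun i => ?_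
  simp only [h]
  exact (IsPosTrig.const_mul_wave (by norm_num) _).add
    ((IsPosTrig.const_mul_wave (by norm_num) _).add (IsPosTrig.const_mul_wave (by norm_num) _))

theorem bump_nonneg (y : Eu d) : 0 ≤ bump L y :=
  Finset.prod_nonneg fun i _ => by linarith [Real.neg_one_le_cos (2 * Real.pi * y i / L)]

@[simp] theorem bump_zero : bump L (0 : Eu d) = 1 := by
  simp [bump]

@[fun_prop] theorem continuous_bump : Continuous (bump (d := d) L) := by
  unfold bump
  fun_prop

theorem bump_lt_one (hL : 0 < L) {y : Eu d} (hy : y ∈ closedCube d L) (hne : y ≠ center d L) :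
    bump L (y - center d L) < 1 := by
  obtain ⟨i, hi⟩ : ∃ i, y i ≠ L / 2 := by
    by_contra! h
    exact hne (by ext i; simpa [center] using h i)
  have hle : bump L (y - center d L)
      ≤ (1 + Real.cos (2 * Real.pi * (y - center d L) i / L)) / 2 := by
    rw [bump, ← Finset.mul_prod_erase _ _ (Finset.mem_univ i)]
    refine mul_le_of_le_one_right ?_ (Finset.prod_le_one (fun j _ => ?_) fun j _ => ?_)
    · linarith [Real.neg_one_le_cos (2 * Real.pi * (y - center d L) i / L)]
    · linarith [Real.neg_one_le_cos (2 * Real.pi * (y - center d L) j / L)]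
    · linarith [Real.cos_le_one (2 * Real.pi * (y - center d L) j / L)]
  refine hle.trans_lt ?_
  have ht : (y - center d L) i = y i - L / 2 := by simp [center]
  rw [ht]
  have hyi := hy i
  rw [Set.mem_Icc] at hyi
  have hcos : Real.cos (2 * Real.pi * (y i - L / 2) / L) ≠ 1 := by
    intro h
    have hpi := Real.pi_pos
    have h0 := (Real.cos_eq_one_iff_of_lt_of_lt (x := 2 * Real.pi * (y i - L / 2) / L) ?_ ?_).1 h
    · rw [_root_.div_eq_zero_iff] at h0
      rcases h0 with h0 | h0
      · rcases mul_eq_zero.1 h0 with h0 | h0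
        · linarith
        · exact hi (by linarith)
      · exact hL.ne' h0
    · rw [lt_div_iff₀ hL]
      nlinarith [mul_pos hpi hL]
    · rw [div_lt_iff₀ hL]
      nlinarith [mul_pos hpi hL]
  have := lt_of_le_of_ne (Real.cos_le_one _) hcos
  linarith

theorem center_mem_interior (hL : 0 < L) :
    center d L ∈ interior (closedCube d L) := by
  rw [mem_interior]
  refine ⟨{x | ∀ i, x i ∈ Set.Ioo (0 : ℝ) L}, fun x hx i => Set.Ioo_subset_Icc_self (hx i), ?_, ?_⟩
  · simp only [Set.ofPred_forall]
    exact isOpen_iInter_of_finite fun i => isOpen_Ioo.preimage (by fun_prop)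
  · intro i
    simp only [center, Set.mem_Ioo]
    constructor <;> linarith

theorem tendsto_bump_peak (hL : 0 < L) {E : Type*} [NormedAddCommGroup E] [NormedSpace ℝ E]
    [CompleteSpace E] {g : Eu d → E} (hg : IntegrableOn (fun y => g (y - center d L)) (cube d L))
    (hg0 : ContinuousAt g 0) :
    Tendsto (fun n : ℕ => (∫ y in cube d L, bump L (y - center d L) ^ n)⁻¹ •
      ∫ y in cube d L, bump L (y - center d L) ^ n • g (y - center d L)) atTop (𝓝 (g 0)) := by
  have h := tendsto_setIntegral_pow_smul_of_unique_maximum_of_isCompact_of_integrableOn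
    (μ := volume) (s := closedCube d L) (x₀ := center d L)
    (c := fun y => bump L (y - center d L)) (g := fun y => g (y - center d L))
    isCompact_closedCube (by fun_prop)
    (fun y hy hne => by simpa using bump_lt_one hL hy hne) (fun y _ => bump_nonneg _)
    (by simp) (subset_closure (center_mem_interior hL))
    (hg.congr_set_ae cube_ae_eq_closedCube.symm)
    (by
      refine ContinuousAt.continuousWithinAt ?_
      refine ContinuousAt.comp (f := fun y => y - center d L) (g := g) ?_ (by fun_prop)
      simpa using hg0)
  simp only [sub_self] at h
  simpa only [setIntegral_congr_set (μ := volume) (cube_ae_eq_closedCube (d := d) (L := L))] using h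

end PosTrig

/-! ### The Fourier series of the periodization -/

section Periodization

variable {d : ℕ} {L : ℝ} {f : Eu d → ℝ}

theorem ofReal_toReal_fper (hf_nonneg : ∀ x, 0 ≤ f x) (x : Eu d) :
    ((fper d f L x).toReal : ℂ) = ∑' z : Fin d → ℤ, (f (x - latPt d L z) : ℂ) := by
  rw [fper, ENNReal.tsum_toReal_eq fun z => ENNReal.ofReal_ne_top, Complex.ofReal_tsum]
  simp only [ENNReal.toReal_ofReal (hf_nonneg _)]

theorem lintegral_fper_lt_top (hL : 0 < L) (hf : Integrable f) (x : Eu d) :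
    ∫⁻ y in cube d L, fper d f L (x + (y - center d L)) < ⊤ := by
  have h1 : ∫⁻ y in cube d L, fper d f L (x + (y - center d L))
      = ∫⁻ y, ENNReal.ofReal (f (x + (y - center d L))) := by
    rw [← tsum_lintegral_cube_sub hL, ← lintegral_tsum]
    · refine lintegral_congr fun y => tsum_congr fun z => ?_
      congr 2
      abel
    · intro z
      exact ((((hf.comp_add_left x).comp_sub_right (center d L)).comp_sub_right
        (latPt d L z)).aestronglyMeasurable.aemeasurable.ennreal_ofReal).restrict
  rw [h1]
  exact ((hf.comp_add_left x).comp_sub_right (center d L)).lintegral_lt_top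

theorem integrableOn_fper (hL : 0 < L) (hf : Integrable f) (hper : Continuous (fper d f L))
    (x : Eu d) :
    IntegrableOn (fun y => (fper d f L (x + (y - center d L))).toReal) (cube d L) :=
  integrable_toReal_of_lintegral_ne_top (by fun_prop) (lintegral_fper_lt_top hL hf x).ne

theorem fourier_dualPt (k : Fin d → ℤ) :
    𝓕 (fun x => (f x : ℂ)) (dualPt d L k) = ∫ x, (f x : ℂ) * wave L (-k) x := by
  rw [Real.fourier_eq']
  refine integral_congr_ae (ae_of_all _ fun x => ?_)
  simp only [smul_eq_mul]
  rw [mul_comm, wave]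
  congr 2
  simp only [PiLp.inner_apply, dualPt, WithLp.equiv_symm_apply, RCLike.inner_apply, conj_trivial]
  push_cast
  rw [Finset.mul_sum, Finset.sum_mul]
  refine Finset.sum_congr rfl fun i _ => ?_
  simp only [Pi.neg_apply, Int.cast_neg]
  ring

theorem integral_fper_mul_wave (hL : 0 < L) (hf_nonneg : ∀ x, 0 ≤ f x) (hf : Integrable f)
    (x : Eu d) (k : Fin d → ℤ) :
    ∫ y in cube d L, ((fper d f L (x + (y - center d L))).toReal : ℂ)
        * wave L (-k) (y - center d L)
      = wave L k x * 𝓕 (fun x => (f x : ℂ)) (dualPt d L k) := by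
  have hfc : Integrable fun y => (f y : ℂ) * wave L (-k) y :=
    hf.ofReal.mul_bdd (c := 1) (continuous_wave _).aestronglyMeasurable
      (ae_of_all _ fun y => (norm_wave _ _).le)
  have hF : Integrable fun y => wave L k x *
      ((f (x + (y - center d L)) : ℂ) * wave L (-k) (x + (y - center d L))) :=
    ((hfc.comp_add_left x).comp_sub_right (center d L)).const_mul _
  have h := integral_cube_tsum_sub hL hF
  rw [integral_const_mul, integral_sub_right_eq_self
      (fun y => (f (x + y) : ℂ) * wave L (-k) (x + y)) (center d L),
    integral_add_left_eq_self (fun y => (f y : ℂ) * wave L (-k) y) x, ← fourier_dualPt] at h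
  rw [← h]
  refine integral_congr_ae (ae_of_all _ fun y => ?_)
  simp only
  rw [ofReal_toReal_fper hf_nonneg, ← tsum_mul_right]
  refine tsum_congr fun z => ?_
  have e1 : x + (y - latPt d L z - center d L) = x + (y - center d L) - latPt d L z := by abel
  have e2 : wave L (-k) (x + (y - center d L) - latPt d L z)
      = wave L (-k) x * wave L (-k) (y - center d L) := by
    rw [sub_eq_add_neg _ (latPt d L z), wave_add, wave_add, wave_neg, neg_neg, wave_latPt hL,
      mul_one]
  rw [e1, e2]
  linear_combination (-(f (x + (y - center d L) - latPt d L z) : ℂ)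
    * wave L (-k) (y - center d L)) * wave_neg_mul_self (L := L) k x

theorem exists_fourier_weights (hL : 0 < L) (hf_nonneg : ∀ x, 0 ≤ f x) (hf : Integrable f)
    (hper : Continuous (fper d f L)) :
    ∃ (w : ℕ → (Fin d → ℤ) → ℝ) (T : ℕ → Finset (Fin d → ℤ)),
      (∀ n k, 0 ≤ w n k) ∧ (∀ n k, w n k ≤ 1) ∧ (∀ n, ∀ k ∉ T n, w n k = 0) ∧
      (∀ k, Tendsto (fun n => w n k) atTop (𝓝 1)) ∧
      ∀ x, fper d f L x ≠ ⊤ → Tendsto (fun n => ∑ k ∈ T n,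
        (w n k : ℂ) * (wave L k x * 𝓕 (fun x => (f x : ℂ)) (dualPt d L k))) atTop
          (𝓝 ((L : ℂ) ^ d * (fper d f L x).toReal)) := by
  choose T b hb0 hbT hb using fun n : ℕ => ((isPosTrig_bump (d := d) (L := L)).pow n).exists_finset
  set c := center d L with hc
  set H : ℕ → ℝ := fun n => ∫ y in cube d L, bump L (y - c) ^ n with hH
  have hH0 : ∀ n, 0 ≤ H n := fun n => integral_nonneg fun y => pow_nonneg (bump_nonneg _) n
  have hcont : ∀ {F : Eu d → ℂ}, Continuous F → IntegrableOn F (cube d L) := by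
    intro F hF
    exact (hF.continuousOn.integrableOn_compact isCompact_closedCube).congr_set_ae
      cube_ae_eq_closedCube
  have hcoef : ∀ n k, ∫ y in cube d L, bump L (y - c) ^ n • wave L k (y - c)
      = (L : ℂ) ^ d * b n k := by
    intro n k
    have h1 : ∀ y : Eu d, bump L (y - c) ^ n • wave L k (y - c)
        = ∑ l ∈ T n, ((b n l : ℂ) * wave L (l - k) c) * wave L (k - l) y := by
      intro y
      have := hb n (y - c)
      rw [Complex.real_smul, Complex.ofReal_pow, this, Finset.sum_mul]
      refine Finset.sum_congr rfl fun l _ => ?_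
      have h2 : wave L (k - l) (y - c) = wave L (k - l) y * wave L (l - k) c := by
        rw [sub_eq_add_neg y, wave_add, wave_neg, neg_sub]
      rw [mul_assoc, ← wave_index_add, mul_assoc, mul_comm (wave L (l - k) c), ← h2,
        neg_add_eq_sub]
    simp only [h1]
    rw [integral_finsetSum _ fun l _ => (hcont (continuous_wave _)).const_mul _]
    simp only [integral_const_mul, integral_cube_wave hL, sub_eq_zero]
    by_cases hk : k ∈ T n
    · rw [Finset.sum_eq_single k]
      · simp [mul_comm]
      · intro l _ hl
        rw [if_neg hl.symm, mul_zero]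
      · exact fun h => absurd hk h
    · rw [hbT n k hk, Complex.ofReal_zero, mul_zero]
      refine Finset.sum_eq_zero fun l hl => ?_
      rw [if_neg (fun h : k = l => hk (h ▸ hl)), mul_zero]
  have hweight : ∀ n k, (((H n)⁻¹ * (L ^ d * b n k) : ℝ) : ℂ)
      = (H n)⁻¹ • ∫ y in cube d L, bump L (y - c) ^ n • wave L k (y - c) := by
    intro n k
    rw [hcoef, Complex.real_smul]
    push_cast
    ring
  refine ⟨fun n k => (H n)⁻¹ * (L ^ d * b n k), T, fun n k => ?_, fun n k => ?_, fun n k hk => ?_,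
    fun k => ?_, fun x hx => ?_⟩
  · exact mul_nonneg (inv_nonneg.2 (hH0 n)) (mul_nonneg (pow_nonneg hL.le _) (hb0 n k))
  · have h1 : L ^ d * b n k ≤ H n := by
      have h2 : ‖(L : ℂ) ^ d * b n k‖ ≤ H n := by
        rw [← hcoef]
        refine (norm_integral_le_integral_norm _).trans (le_of_eq ?_)
        refine integral_congr_ae (ae_of_all _ fun y => ?_)
        simp only [norm_smul, norm_wave, mul_one]
        exact Real.norm_of_nonneg (pow_nonneg (bump_nonneg _) n)
      rw [← Complex.ofReal_pow, ← Complex.ofReal_mul, Complex.norm_real] at h2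
      exact (Real.le_norm_self _).trans h2
    exact inv_mul_le_one_of_le₀ h1 (hH0 n)
  · simp [hbT n k hk]
  · have h := tendsto_bump_peak hL (g := wave L k) (hcont (by fun_prop))
      (continuous_wave k).continuousAt
    rw [wave_zero_arg] at h
    refine ((Complex.continuous_re.tendsto _).comp h).congr fun n => ?_
    rw [Function.comp_apply, ← hc, ← hweight, Complex.ofReal_re]
  · have hg0 : ContinuousAt (fun y : Eu d => ((fper d f L (x + y)).toReal : ℂ)) 0 := by
      refine Complex.continuous_ofReal.continuousAt.comp ?_
      refine ContinuousAt.comp (g := ENNReal.toReal) ?_ (by fun_prop)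
      simpa using ENNReal.continuousAt_toReal hx
    have hgi := (integrableOn_fper hL hf hper x).ofReal (𝕜 := ℂ)
    have h := tendsto_bump_peak hL (g := fun y => ((fper d f L (x + y)).toReal : ℂ)) hgi hg0
    have h' := h.const_mul ((L : ℂ) ^ d)
    simp only [add_zero] at h'
    refine h'.congr fun n => ?_
    have h1 : ∀ y : Eu d, bump L (y - c) ^ n • ((fper d f L (x + (y - c))).toReal : ℂ)
        = ∑ k ∈ T n, (b n k : ℂ) *
          (((fper d f L (x + (y - c))).toReal : ℂ) * wave L (-k) (y - c)) := by
      intro y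
      rw [Complex.real_smul, Complex.ofReal_pow, hb n (y - c), Finset.sum_mul]
      refine Finset.sum_congr rfl fun k _ => ?_
      ring
    simp only [← hc, h1]
    rw [integral_finsetSum]
    · simp only [integral_const_mul, integral_fper_mul_wave hL hf_nonneg hf, hc]
      rw [Complex.real_smul, Finset.mul_sum, Finset.mul_sum]
      refine Finset.sum_congr rfl fun k _ => ?_
      push_cast
      ring
    · intro k _
      refine Integrable.const_mul ?_ _
      exact hgi.mul_bdd (c := 1) (by fun_prop) (ae_of_all _ fun y => (norm_wave _ _).le)

/-- If the periodization is finite at the origin, it is everywhere the sum of its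
absolutely convergent Fourier series. -/
theorem fper_fourier_series (hL : 0 < L) (hf_nonneg : ∀ x, 0 ≤ f x) (hf : Integrable f)
    (hper : Continuous (fper d f L)) {a : (Fin d → ℤ) → ℝ} (ha0 : ∀ k, 0 ≤ a k)
    (ha : ∀ k, 𝓕 (fun x => (f x : ℂ)) (dualPt d L k) = a k) (h0 : fper d f L 0 ≠ ⊤) :
    Summable a ∧ ∀ x, fper d f L x ≠ ⊤ ∧
      (L : ℂ) ^ d * (fper d f L x).toReal = ∑' k, (a k : ℂ) * wave L k x := by
  obtain ⟨w, T, hw0, hw1, hwT, hw, hlim⟩ := exists_fourier_weights hL hf_nonneg hf hper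
  simp only [ha] at hlim
  have hlim0 : Tendsto (fun n => ∑ k ∈ T n, w n k * a k) atTop
      (𝓝 (L ^ d * (fper d f L 0).toReal)) := by
    have h := (Complex.continuous_re.tendsto _).comp (hlim 0 h0)
    have e : ((L : ℂ) ^ d * (fper d f L 0).toReal).re = L ^ d * (fper d f L 0).toReal := by
      rw [← Complex.ofReal_pow, ← Complex.ofReal_mul, Complex.ofReal_re]
    rw [e] at h
    refine h.congr fun n => ?_
    simp only [Function.comp_apply, wave_zero_arg, one_mul, ← Complex.ofReal_mul,
      ← Complex.ofReal_sum, Complex.ofReal_re]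
  have hsum : Summable a := by
    refine summable_of_sum_le (c := L ^ d * (fper d f L 0).toReal) ha0 fun S => ?_
    have hS : Tendsto (fun n => ∑ k ∈ S, w n k * a k) atTop (𝓝 (∑ k ∈ S, 1 * a k)) :=
      tendsto_finsetSum _ fun k _ => (hw k).mul_const _
    simp only [one_mul] at hS
    refine le_of_tendsto_of_tendsto' hS hlim0 fun n => ?_
    have hnn : ∀ k, 0 ≤ w n k * a k := fun k => mul_nonneg (hw0 n k) (ha0 k)
    calc ∑ k ∈ S, w n k * a k ≤ ∑ k ∈ S ∪ T n, w n k * a k :=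
          Finset.sum_le_sum_of_subset_of_nonneg Finset.subset_union_left fun k _ _ => hnn k
      _ = ∑ k ∈ T n, w n k * a k :=
          (Finset.sum_subset Finset.subset_union_right
            fun k _ hk => by rw [hwT n k hk, zero_mul]).symm
  have hseries : ∀ x, fper d f L x ≠ ⊤ →
      (L : ℂ) ^ d * (fper d f L x).toReal = ∑' k, (a k : ℂ) * wave L k x := by
    intro x hx
    have h1 : Tendsto (fun n => ∑' k, (w n k : ℂ) * (wave L k x * a k)) atTop
        (𝓝 (∑' k, (a k : ℂ) * wave L k x)) := by
      refine tendsto_tsum_of_dominated_convergence hsum (fun k => ?_)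
        (Eventually.of_forall fun n k => ?_)
      · have := (((Complex.continuous_ofReal.tendsto 1).comp (hw k)).mul_const
          (wave L k x * (a k : ℂ)))
        simpa [mul_comm] using this
      · rw [norm_mul, norm_mul, norm_wave, one_mul, Complex.norm_real, Complex.norm_real,
          Real.norm_of_nonneg (hw0 n k), Real.norm_of_nonneg (ha0 k)]
        exact mul_le_of_le_one_left (ha0 k) (hw1 n k)
    refine tendsto_nhds_unique (hlim x hx) (h1.congr fun n => ?_)
    exact tsum_eq_sum fun k hk => by simp [hwT n k hk]
  refine ⟨hsum, fun x => ?_⟩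
  suffices hx : fper d f L x ≠ ⊤ from ⟨hx, hseries x hx⟩
  set C : ℝ≥0∞ := ENNReal.ofReal ((L ^ d)⁻¹ * ∑' k, a k) with hC
  have hbound : ∀ y, fper d f L y ≠ ⊤ → fper d f L y ≤ C := by
    intro y hy
    have hpos : 0 < L ^ d := pow_pos hL d
    have h1 : L ^ d * (fper d f L y).toReal ≤ ∑' k, a k := by
      have h2 : ‖(L : ℂ) ^ d * (fper d f L y).toReal‖ ≤ ∑' k, a k := by
        rw [hseries y hy]
        have hn : ∀ k, ‖(a k : ℂ) * wave L k y‖ = a k := fun k => by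
          rw [norm_mul, norm_wave, mul_one, Complex.norm_real, Real.norm_of_nonneg (ha0 k)]
        have := norm_tsum_le_tsum_norm (f := fun k => (a k : ℂ) * wave L k y) (by simpa only [hn])
        simpa only [hn] using this
      rw [← Complex.ofReal_pow, ← Complex.ofReal_mul, Complex.norm_real] at h2
      exact (Real.le_norm_self _).trans h2
    rw [← ENNReal.ofReal_toReal hy]
    refine ENNReal.ofReal_le_ofReal ?_
    rwa [le_inv_mul_iff₀ hpos]
  intro hx
  have hU : IsOpen {y : Eu d | C < fper d f L (x + (y - center d L))} :=
    isOpen_lt continuous_const (by fun_prop)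
  have hV : IsOpen (interior (closedCube d L) ∩ {y | C < fper d f L (x + (y - center d L))}) :=
    isOpen_interior.inter hU
  have hmem : center d L ∈
      interior (closedCube d L) ∩ {y | C < fper d f L (x + (y - center d L))} := by
    refine ⟨center_mem_interior hL, ?_⟩
    simp [hx, hC]
  have hfin : ∀ᵐ y ∂(volume.restrict (closedCube d L)),
      fper d f L (x + (y - center d L)) < ⊤ := by
    rw [← Measure.restrict_congr_set cube_ae_eq_closedCube]
    exact ae_lt_top (by fun_prop) (lintegral_fper_lt_top hL hf x).ne
  rw [ae_restrict_iff' isCompact_closedCube.measurableSet] at hfin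
  have hzero : volume (interior (closedCube d L) ∩
      {y | C < fper d f L (x + (y - center d L))}) = 0 := by
    refine measure_mono_null ?_ hfin
    rintro y ⟨hy1, hy2⟩ h
    exact absurd (hbound _ (h (interior_subset hy1)).ne) (not_le.2 hy2)
  exact (hV.measure_pos volume ⟨_, hmem⟩).ne' hzero

end Periodization

/-! ### Gibbs weights of permutations -/

section Gibbs

variable {d : ℕ} {L : ℝ} {f : Eu d → ℝ}

theorem prod_wave_sub {N : ℕ} (π : Equiv.Perm (Fin N)) (K : Fin N → Fin d → ℤ)
    (x : Fin N → Eu d) :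
    ∏ i, wave L (K i) (x i - x (π i)) = ∏ i, wave L (K i - K (π.symm i)) (x i) := by
  have h1 : ∀ i, wave L (K i) (x i - x (π i)) = wave L (K i) (x i) * wave L (-K i) (x (π i)) := by
    intro i
    rw [sub_eq_add_neg, wave_add, wave_neg]
  have h2 : ∏ i, wave L (-K i) (x (π i)) = ∏ i, wave L (-K (π.symm i)) (x i) := by
    rw [← Equiv.prod_comp π fun i => wave L (-K (π.symm i)) (x i)]
    simp
  simp only [h1, sub_eq_add_neg (K _), wave_index_add, Finset.prod_mul_distrib, h2]

theorem integral_prod_wave_sub (hL : 0 < L) {N : ℕ} (π : Equiv.Perm (Fin N))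
    (K : Fin N → Fin d → ℤ) :
    ∫ x in Set.univ.pi (fun _ : Fin N => cube d L), ∏ i, wave L (K i) (x i - x (π i))
      = if ∀ i, K (π i) = K i then ((L : ℂ) ^ d) ^ N else 0 := by
  simp only [prod_wave_sub]
  rw [volume_pi, Measure.restrict_pi_pi,
    integral_fintype_prod_eq_prod (f := fun i => wave L (K i - K (π.symm i)))]
  simp only [integral_cube_wave hL, sub_eq_zero, Finset.prod_ite_zero, Finset.prod_const,
    Finset.card_univ, Fintype.card_fin, Finset.mem_univ, true_imp_iff]
  refine if_congr ⟨fun h i => ?_, fun h i => ?_⟩ rfl rfl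
  · simpa using h (π i)
  · simpa using h (π.symm i)

theorem integral_prod_fourier_series (hL : 0 < L) {N : ℕ} (π : Equiv.Perm (Fin N))
    {a : (Fin d → ℤ) → ℝ} (ha0 : ∀ k, 0 ≤ a k) (ha1 : ∀ k, a k ≤ 1) (ha : Summable a) :
    ∫ x in Set.univ.pi (fun _ : Fin N => cube d L),
        ∏ i, ∑' k, (a k : ℂ) * wave L k (x i - x (π i))
      = ((L : ℂ) ^ d) ^ N *
        (∏ j ∈ Finset.Icc 1 N, (∑' k, a k ^ j) ^ cycCount π j : ℝ) := by
  set μ : Measure (Fin N → Eu d) :=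
    volume.restrict (Set.univ.pi fun _ : Fin N => cube d L) with hμ
  have hfinite : IsFiniteMeasure μ := by
    rw [hμ, volume_pi, Measure.restrict_pi_pi]
    infer_instance
  let F : (Fin N → Fin d → ℤ) → (Fin N → Eu d) → ℂ :=
    fun K x => ∏ i, (a (K i) : ℂ) * wave L (K i) (x i - x (π i))
  have hnorm : ∀ K x, ‖F K x‖ = ∏ i, a (K i) := by
    intro K x
    rw [norm_prod]
    refine Finset.prod_congr rfl fun i _ => ?_
    rw [norm_mul, norm_wave, mul_one, Complex.norm_real, Real.norm_of_nonneg (ha0 _)]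
  have hFcont : ∀ K, Continuous (F K) := fun K => by fun_prop
  have hexp : ∀ x : Fin N → Eu d, ∏ i, ∑' k, (a k : ℂ) * wave L k (x i - x (π i))
      = ∑' K, F K x := by
    intro x
    refine (summable_norm_prod_pi_and_tsum
      (fun i k => (a k : ℂ) * wave L k (x i - x (π i))) fun i => ?_).2.symm
    refine ha.congr fun k => ?_
    rw [norm_mul, norm_wave, mul_one, Complex.norm_real, Real.norm_of_nonneg (ha0 _)]
  have hK := (summable_norm_prod_pi_and_tsum (fun (_ : Fin N) k => a k) fun _ => ha.norm).1
  have hKsum : Summable fun K : Fin N → Fin d → ℤ => ∏ i, a (K i) :=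
    hK.congr fun K => Real.norm_of_nonneg (Finset.prod_nonneg fun i _ => ha0 _)
  have hsum := hasSum_integral_of_summable_integral_norm (μ := μ) (F := F)
    (fun K => Integrable.of_bound (hFcont K).aestronglyMeasurable _
      (ae_of_all _ fun x => (hnorm K x).le))
    (by simpa only [hnorm, integral_const] using hKsum.const_smul _)
  simp only [hexp]
  rw [← hsum.tsum_eq, ← Equiv.Perm.tsum_invariant_prod π a ha0 ha ha1, Complex.ofReal_tsum,
    ← tsum_mul_left]
  refine tsum_congr fun K => ?_
  simp only [F, Finset.prod_mul_distrib]
  rw [integral_const_mul, integral_prod_wave_sub hL]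
  split_ifs
  · push_cast
    ring
  · simp

theorem lintegral_prod_fper (hL : 0 < L) (hf_nonneg : ∀ x, 0 ≤ f x) (hf : Integrable f)
    (hper : Continuous (fper d f L)) {a : (Fin d → ℤ) → ℝ} (ha0 : ∀ k, 0 ≤ a k)
    (ha1 : ∀ k, a k ≤ 1) (ha : ∀ k, 𝓕 (fun x => (f x : ℂ)) (dualPt d L k) = a k)
    (h0 : fper d f L 0 ≠ ⊤) {N : ℕ} (π : Equiv.Perm (Fin N)) :
    ∫⁻ x in Set.univ.pi (fun _ : Fin N => cube d L), ∏ i, fper d f L (x i - x (π i))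
      = ENNReal.ofReal (∏ j ∈ Finset.Icc 1 N, (∑' k, a k ^ j) ^ cycCount π j) := by
  obtain ⟨hsum, hser⟩ := fper_fourier_series hL hf_nonneg hf hper ha0 ha h0
  have hGcont : Continuous fun x => (fper d f L x).toReal := by
    rw [continuous_iff_continuousAt]
    intro x
    exact ContinuousAt.comp (g := ENNReal.toReal) (ENNReal.continuousAt_toReal (hser x).1)
      hper.continuousAt
  have h1 : ∀ x : Fin N → Eu d, ∏ i, fper d f L (x i - x (π i))
      = ENNReal.ofReal (∏ i, (fper d f L (x i - x (π i))).toReal) := by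
    intro x
    rw [ENNReal.ofReal_prod_of_nonneg fun i _ => ENNReal.toReal_nonneg]
    exact Finset.prod_congr rfl fun i _ => (ENNReal.ofReal_toReal (hser _).1).symm
  have hcont : Continuous fun x : Fin N → Eu d =>
      ∏ i, (fper d f L (x i - x (π i))).toReal :=
    continuous_finsetProd _ fun i _ => hGcont.comp (by fun_prop)
  have hint : IntegrableOn (fun x : Fin N → Eu d =>
      ∏ i, (fper d f L (x i - x (π i))).toReal) (Set.univ.pi fun _ : Fin N => cube d L) :=
    (hcont.continuousOn.integrableOn_compact
      (isCompact_univ_pi fun _ => isCompact_closedCube)).mono_set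
      (Set.pi_mono fun i _ x hx j => Set.Ico_subset_Icc_self (hx j))
  simp only [h1]
  rw [← ofReal_integral_eq_lintegral_ofReal hint
    (ae_of_all _ fun x => Finset.prod_nonneg fun i _ => ENNReal.toReal_nonneg)]
  congr 1
  have hLN : ((L : ℂ) ^ d) ^ N ≠ 0 := by
    have : (L : ℂ) ≠ 0 := by exact_mod_cast hL.ne'
    positivity
  rw [← Complex.ofReal_inj]
  refine mul_left_cancel₀ hLN ?_
  rw [← integral_prod_fourier_series hL π ha0 ha1 hsum, ← integral_complex_ofReal,
    ← integral_const_mul]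
  refine integral_congr_ae (ae_of_all _ fun x => ?_)
  simp only [← (hser _).2, Finset.prod_mul_distrib, Finset.prod_const, Finset.card_univ,
    Fintype.card_fin, Complex.ofReal_prod]

theorem gibbsW_one_eq_top (hL : 0 < L) (α : ℕ → ℝ) {N : ℕ} (hN : N ≠ 0)
    (h0 : fper d f L 0 = ⊤) : gibbsW d f α L N 1 = ⊤ := by
  have hcube : volume (cube d L) ≠ 0 := by
    rw [measure_congr cube_ae_eq_closedCube]
    exact ((isOpen_interior.measure_pos volume ⟨_, center_mem_interior hL⟩).trans_le
      (measure_mono interior_subset)).ne'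
  have hw : ENNReal.ofReal (permWeight α (1 : Equiv.Perm (Fin N))) ≠ 0 := by
    simp [permWeight, Real.exp_pos]
  rw [gibbsW]
  simp only [Equiv.Perm.coe_one, id_eq, sub_self, h0, Finset.prod_const, Finset.card_univ,
    Fintype.card_fin, ENNReal.top_pow hN, setLIntegral_const]
  rw [volume_pi, Measure.pi_pi, ENNReal.top_mul (by simp [hcube]), ENNReal.mul_top hw]

theorem gibbsW_eq_prod (hL : 0 < L) (hf_nonneg : ∀ x, 0 ≤ f x) (hf : Integrable f)
    (hper : Continuous (fper d f L)) {ε : Eu d → ℝ} (hε : ∀ k, 0 ≤ ε k)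
    (hFT : ∀ k : Eu d, 𝓕 (fun x => (f x : ℂ)) k = (Real.exp (-ε k) : ℂ))
    (h0 : fper d f L 0 ≠ ⊤) (α : ℕ → ℝ) {N : ℕ} (π : Equiv.Perm (Fin N)) :
    gibbsW d f α L N π = ∏ j ∈ Finset.Icc 1 N, (ENNReal.ofReal (Real.exp (-α j)) *
      ∑' z : Fin d → ℤ, ENNReal.ofReal (Real.exp (-(j : ℝ) * ε (dualPt d L z)))) ^
        cycCount π j := by
  set a : (Fin d → ℤ) → ℝ := fun k => Real.exp (-ε (dualPt d L k)) with ha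
  have ha0 : ∀ k, 0 ≤ a k := fun k => (Real.exp_pos _).le
  have ha1 : ∀ k, a k ≤ 1 := fun k => Real.exp_le_one_iff.2 (neg_nonpos.2 (hε _))
  have haF : ∀ k, 𝓕 (fun x => (f x : ℂ)) (dualPt d L k) = a k := fun k => hFT _
  have hsum := (fper_fourier_series hL hf_nonneg hf hper ha0 haF h0).1
  have hpw : permWeight α π = ∏ j ∈ Finset.Icc 1 N, Real.exp (-α j) ^ cycCount π j := by
    rw [permWeight, ← Finset.sum_neg_distrib, Real.exp_sum]
    refine Finset.prod_congr rfl fun j _ => ?_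
    rw [← Real.exp_nat_mul]
    congr 1
    ring
  rw [gibbsW, lintegral_prod_fper hL hf_nonneg hf hper ha0 ha1 haF h0 π, hpw,
    ENNReal.ofReal_prod_of_nonneg (fun j _ => pow_nonneg (Real.exp_pos _).le _),
    ENNReal.ofReal_prod_of_nonneg
      (fun j _ => pow_nonneg (tsum_nonneg fun k => pow_nonneg (ha0 k) _) _),
    ← Finset.prod_mul_distrib]
  refine Finset.prod_congr rfl fun j hj => ?_
  have hj1 : j ≠ 0 := Nat.one_le_iff_ne_zero.1 (Finset.mem_Icc.1 hj).1
  rw [mul_pow, ENNReal.ofReal_pow (Real.exp_pos _).le,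
    ENNReal.ofReal_pow (tsum_nonneg fun k => pow_nonneg (ha0 k) _),
    ENNReal.ofReal_tsum_of_nonneg (fun k => pow_nonneg (ha0 k) _)
      (Summable.of_nonneg_of_le (fun k => pow_nonneg (ha0 k) _)
        (fun k => pow_le_of_le_one (ha0 k) (ha1 k) hj1) hsum)]
  have hpow : ∀ k, a k ^ j = Real.exp (-(j : ℝ) * ε (dualPt d L k)) := fun k => by
    rw [ha, ← Real.exp_nat_mul, mul_neg, neg_mul]
  simp only [hpow]

/-- The total Gibbs weight of the permutations with prescribed cycle numbers. -/
theorem sum_gibbsW_cycCount (hL : 0 < L) (hf_nonneg : ∀ x, 0 ≤ f x) (hf : Integrable f)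
    (hper : Continuous (fper d f L)) {ε : Eu d → ℝ} (hε : ∀ k, 0 ≤ ε k)
    (hFT : ∀ k : Eu d, 𝓕 (fun x => (f x : ℂ)) k = (Real.exp (-ε k) : ℂ))
    (h0 : fper d f L 0 ≠ ⊤) (α : ℕ → ℝ) {N : ℕ} {r : ℕ → ℕ}
    (hr : ∑ j ∈ Finset.Icc 1 N, j * r j = N) :
    (∑ π : Equiv.Perm (Fin N),
        if ∀ j ∈ Finset.Icc 1 N, cycCount π j = r j then gibbsW d f α L N π else 0)
      = N.factorial * ∏ j ∈ Finset.Icc 1 N, ((r j).factorial : ℝ≥0∞)⁻¹ *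
        (ENNReal.ofReal (Real.exp (-α j) / j) *
          ∑' z : Fin d → ℤ, ENNReal.ofReal (Real.exp (-(j : ℝ) * ε (dualPt d L z)))) ^ (r j) := by
  rw [← Finset.sum_filter (fun π : Equiv.Perm (Fin N) =>
      ∀ j ∈ Finset.Icc 1 N, cycCount π j = r j) fun π => gibbsW d f α L N π,
    ← Equiv.Perm.card_cycCount_eq_mul hr, Nat.cast_mul, mul_assoc,
    Nat.cast_prod, ← Finset.prod_mul_distrib, ← nsmul_eq_mul]
  refine Finset.sum_eq_card_nsmul fun π hπ => ?_
  have hcyc := ((@Finset.mem_filter _ _ (_) _ _).1 hπ).2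
  rw [gibbsW_eq_prod hL hf_nonneg hf hper hε hFT h0]
  refine Finset.prod_congr rfl fun j hj => ?_
  rw [hcyc j hj]
  have hj1 : 0 < j := (Finset.mem_Icc.1 hj).1
  have hj0 : (j : ℝ≥0∞) ≠ 0 := by exact_mod_cast hj1.ne'
  have hfac : ((r j).factorial : ℝ≥0∞) ≠ 0 := by exact_mod_cast (r j).factorial_ne_zero
  set S := ∑' z : Fin d → ℤ, ENNReal.ofReal (Real.exp (-(j : ℝ) * ε (dualPt d L z)))
  rw [ENNReal.ofReal_div_of_pos (by exact_mod_cast hj1), ENNReal.ofReal_natCast, div_eq_mul_inv]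
  set A := ENNReal.ofReal (Real.exp (-α j))
  push_cast
  calc (A * S) ^ r j
      = (((r j).factorial : ℝ≥0∞) * ((r j).factorial : ℝ≥0∞)⁻¹) *
          ((j : ℝ≥0∞) * (j : ℝ≥0∞)⁻¹) ^ r j * (A * S) ^ r j := by
        rw [ENNReal.mul_inv_cancel hfac (ENNReal.natCast_ne_top _),
          ENNReal.mul_inv_cancel hj0 (ENNReal.natCast_ne_top _)]
        simp
    _ = _ := by ring

end Gibbs

/-- Proposition 3.1: for nonnegative integers `r_1, …, r_N` with
`∑_j j·r_j = N`, the probability under the Gibbs measure that the permutation has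
exactly `r_j` cycles of length `j` for each `j` equals
`Y⁻¹ ∏_{j=1}^N (r_j!)⁻¹ ((e^{-α_j}/j) ∑_{k∈Λ*} e^{-jε(k)})^{r_j}`. -/
theorem statement4
    (d : ℕ) (hd : 1 ≤ d) (f ε : Eu d → ℝ) (α : ℕ → ℝ)
    -- assumptions on the jump function `f = e^{-ξ}`
    (hf_cont : Continuous f) (hf_nonneg : ∀ x, 0 ≤ f x)
    (hf_norm : ∫ x : Eu d, f x = 1)
    -- the Fourier transform of `e^{-ξ}` is the positive function `e^{-ε}`
    (hFT : ∀ k : Eu d, 𝓕 (fun x => (f x : ℂ)) k = (Real.exp (-ε k) : ℂ))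
    (hε_nonneg : ∀ k, 0 ≤ ε k)
    -- the box and the periodization, assumed continuous
    (L : ℝ) (hL : 0 < L) (hper_cont : Continuous (fper d f L))
    -- the cycle numbers
    (N : ℕ) (r : ℕ → ℕ) (hr : ∑ j ∈ Finset.Icc 1 N, j * r j = N)
    -- the Gibbs normalization `Y`
    (Y : ℝ≥0∞) (hY : Y = (N.factorial : ℝ≥0∞)⁻¹ * ∑ π : Equiv.Perm (Fin N), gibbsW d f α L N π) :
    (∑ π : Equiv.Perm (Fin N),
        if ∀ j ∈ Finset.Icc 1 N, cycCount π j = r j then gibbsW d f α L N π else 0) /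
      ((N.factorial : ℝ≥0∞) * Y) =
    Y⁻¹ * ∏ j ∈ Finset.Icc 1 N, ((r j).factorial : ℝ≥0∞)⁻¹ *
      (ENNReal.ofReal (Real.exp (-α j) / j) *
        ∑' z : Fin d → ℤ, ENNReal.ofReal (Real.exp (-(j : ℝ) * ε (dualPt d L z)))) ^ (r j) := by
  have hf : Integrable f := by
    by_contra h
    rw [integral_undef h] at hf_norm
    exact zero_ne_one hf_norm
  have hfac : (N.factorial : ℝ≥0∞) ≠ 0 := by exact_mod_cast N.factorial_ne_zero
  have hfac' : (N.factorial : ℝ≥0∞) ≠ ⊤ := ENNReal.natCast_ne_top _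
  by_cases h0 : fper d f L 0 = ⊤
  · rcases eq_or_ne N 0 with rfl | hN
    · have hY1 : Y = 1 := by
        rw [hY]
        simp [gibbsW, permWeight, volume_pi]
      rw [hY1]
      simp [gibbsW, permWeight, volume_pi]
    · have hYtop : Y = ⊤ := by
        have h1 : ∑ π : Equiv.Perm (Fin N), gibbsW d f α L N π = ⊤ :=
          ENNReal.sum_eq_top.2 ⟨1, Finset.mem_univ _, gibbsW_one_eq_top hL α hN h0⟩
        rw [hY, h1, ENNReal.mul_top (ENNReal.inv_ne_zero.2 hfac')]
      rw [hYtop, ENNReal.mul_top hfac, ENNReal.div_top, ENNReal.inv_top, zero_mul]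
  · rw [sum_gibbsW_cycCount hL hf_nonneg hf hper_cont hε_nonneg hFT h0 α hr,
      ENNReal.mul_div_mul_left _ _ hfac hfac', mul_comm, ENNReal.div_eq_inv_mul, mul_comm]
end
end

section
/- Let a : ℕ_{≥1} × ℕ → [0,∞] satisfy a(k,0) = 1 for all k ≥ 1. Let 𝒩 be the set of sequences (n_k)_{k≥1} of nonnegative integers with only finitely many nonzero entries. Then ∑_{n∈𝒩} ∏_{k≥1} a(k, n_k) = lim_{m→∞} ∏_{k=1}^m ( ∑_{n≥0} a(k,n) ), as an identity in [0,∞] (each product over k ≥ 1 reduces to a finite product since all but finitely many factors equal 1, and the limit on the right exists since each factor is ≥ 1). -/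
open Filter Topology ENNReal

/-- Finite products of series in `[0,∞]` expand as sums over the finitely supported functions
whose support is contained in the index set. -/
theorem ENNReal.finset_prod_tsum_eq_tsum_finsupp {ι : Type*} (a : ι → ℕ → ℝ≥0∞)
    (ha : ∀ k, a k 0 = 1) (s : Finset ι) :
    ∏ k ∈ s, ∑' n, a k n = ∑' f : {f : ι →₀ ℕ // f.support ⊆ s}, f.1.prod a := by
  classical
  induction s using Finset.induction_on with
  | empty =>
    rw [tsum_eq_single ⟨0, by simp⟩]
    · simp
    · rintro ⟨f, hf⟩ h
      exact absurd (Subtype.ext (Finsupp.support_eq_empty.1 (Finset.subset_empty.1 hf))) h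
  | insert i s hi ih =>
    have hzero : ∀ f : ι →₀ ℕ, f.support ⊆ s → f i = 0 := fun f hf =>
      Finsupp.notMem_support_iff.1 fun h => hi (hf h)
    let e : ℕ × {f : ι →₀ ℕ // f.support ⊆ s} ≃ {f : ι →₀ ℕ // f.support ⊆ insert i s} :=
      { toFun p := ⟨p.2.1.update i p.1, (Finsupp.support_update_subset ..).trans
          (Finset.insert_subset_insert i p.2.2)⟩
        invFun f := (f.1 i, ⟨f.1.erase i, by
          rw [Finsupp.support_erase]
          exact Finset.subset_insert_iff.1 f.2⟩)
        left_inv := by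
          rintro ⟨n, f, hf⟩
          ext j
          · simp
          · by_cases hj : j = i
            · subst hj
              simp [hzero f hf]
            · simp [hj]
        right_inv := by
          rintro ⟨f, hf⟩
          simp }
    rw [Finset.prod_insert hi, ih, ← e.tsum_eq, ENNReal.tsum_prod', ← ENNReal.tsum_mul_right]
    refine tsum_congr fun n => ?_
    rw [← ENNReal.tsum_mul_left]
    refine tsum_congr fun f => ?_
    rw [Finsupp.prod_of_support_subset _ f.2 _ fun k _ => ha k,
      Finsupp.prod_of_support_subset _ (e (n, f)).2 _ fun k _ => ha k, Finset.prod_insert hi]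
    congr 1
    · simp [e]
    · refine Finset.prod_congr rfl fun k hk => ?_
      have hki : k ≠ i := fun h => hi (h ▸ hk)
      simp [e, hki]

theorem ENNReal.hasProd_tsum_finsupp {ι : Type*} (a : ι → ℕ → ℝ≥0∞) (ha : ∀ k, a k 0 = 1) :
    HasProd (fun k => ∑' n, a k n) (∑' f : ι →₀ ℕ, f.prod a) := by
  classical
  have hmono : Monotone fun s : Finset ι => ∏ k ∈ s, ∑' n, a k n := fun s t hst =>
    Finset.prod_le_prod_of_subset_of_one_le' hst fun k _ _ => ha k ▸ ENNReal.le_tsum 0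
  have hsup : ⨆ s : Finset ι, ∏ k ∈ s, ∑' n, a k n = ∑' f : ι →₀ ℕ, f.prod a := by
    simp_rw [ENNReal.finset_prod_tsum_eq_tsum_finsupp a ha]
    refine le_antisymm (iSup_le fun s => ?_) ?_
    · exact ENNReal.tsum_comp_le_tsum_of_injective Subtype.val_injective _
    · rw [ENNReal.tsum_eq_iSup_sum]
      refine iSup_le fun F => le_iSup_of_le (F.biUnion Finsupp.support) ?_
      rw [← Finset.sum_subtype_of_mem (p := fun f => f.support ⊆ F.biUnion Finsupp.support) _
        fun f hf => Finset.subset_biUnion_of_mem Finsupp.support hf]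
      exact ENNReal.sum_le_tsum _
  exact hsup ▸ tendsto_atTop_iSup hmono

/-- Lemma 4.1: if `a : ℕ_{≥1} × ℕ → [0,∞]` satisfies `a(k,0) = 1` for
all `k`, and `𝒩` is the set of finitely supported sequences of nonnegative integers
indexed by `ℕ_{≥1}`, then `∑_{n∈𝒩} ∏_{k≥1} a(k, n_k) = lim_{m→∞} ∏_{k=1}^m ∑_{n≥0} a(k,n)`,
as an identity in `[0,∞]` (for `n ∈ 𝒩`, the product over `k ≥ 1` reduces to the finite
product over the support of `n`, since all other factors equal 1). -/
theorem statement7 (a : ℕ+ → ℕ → ℝ≥0∞) (ha : ∀ k, a k 0 = 1) :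
    Tendsto (fun m : ℕ+ => ∏ k ∈ Finset.Icc 1 m, ∑' n : ℕ, a k n) atTop
      (𝓝 (∑' nn : ℕ+ →₀ ℕ, ∏ k ∈ nn.support, a k (nn k))) := by
  have hIcc : Tendsto (fun m : ℕ+ => Finset.Icc 1 m) atTop atTop :=
    tendsto_atTop_finset_of_monotone (fun _ _ h => Finset.Icc_subset_Icc_right h)
      fun k => ⟨k, Finset.mem_Icc.2 ⟨one_le, le_rfl⟩⟩
  exact (ENNReal.hasProd_tsum_finsupp a ha).comp hIcc
end
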